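/- There is no 2-colouring of K(C_10) containing no monochromatic planar K_4 that is invariant under the full symmetric group S_10 acting on vertices by permuting the 10 coordinates. -/

import Mathlib

/-- The vertex `v : Fin n → Bool` of the hypercube, regarded as a point of `ℝ^n`. -/
def toPoint (n : ℕ) (v : Fin n → Bool) : Fin n → ℝ := fun i => if v i then 1 else 0

/-- The colouring `c` of the edges of `K(C_n)` contains no monochromatic planar `K₄`:
no four distinct coplanar vertices have all six connecting edges the same colour. -/
def NoMonoPlanarK4 (n : ℕ) (c : Sym2 (Fin n → Bool) → Bool) : Prop :=
  ∀ a b d e : Fin n → Bool,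
    a ≠ b → a ≠ d → a ≠ e → b ≠ d → b ≠ e → d ≠ e →
    Coplanar ℝ ({toPoint n a, toPoint n b, toPoint n d, toPoint n e} : Set (Fin n → ℝ)) →
    ¬ (c s(a, b) = c s(a, d) ∧ c s(a, b) = c s(a, e) ∧
       c s(a, b) = c s(b, d) ∧ c s(a, b) = c s(b, e) ∧ c s(a, b) = c s(d, e))

/-- The action of a coordinate permutation on a vertex of the hypercube:
`(σ • v) i = v (σ⁻¹ i)`. -/
def permAct (n : ℕ) (σ : Equiv.Perm (Fin n)) (v : Fin n → Bool) : Fin n → Bool :=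
  fun i => v (σ⁻¹ i)

/-- The vertices of a parallelogram are coplanar. -/
theorem coplanar_of_add_eq_add {V : Type*} [AddCommGroup V] [Module ℝ V] {a b d e : V}
    (h : a + e = b + d) : Coplanar ℝ ({a, b, d, e} : Set V) := by
  have he : e ∈ affineSpan ℝ ({a, b, d} : Set V) := by
    have hm := (affineSpan ℝ ({a, b, d} : Set V)).smul_vsub_vadd_mem (1 : ℝ)
      (mem_affineSpan ℝ (show b ∈ ({a, b, d} : Set V) by simp))
      (mem_affineSpan ℝ (show a ∈ ({a, b, d} : Set V) by simp))
      (mem_affineSpan ℝ (show d ∈ ({a, b, d} : Set V) by simp))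
    have hd : e = (1 : ℝ) • (b -ᵥ a) +ᵥ d := by
      rw [one_smul, vsub_eq_sub, vadd_eq_add, sub_add_eq_add_sub, ← h, add_sub_cancel_left]
    rwa [← hd] at hm
  have hs : ({a, b, d, e} : Set V) = insert e {a, b, d} := by
    ext x
    simp only [Set.mem_insert_iff, Set.mem_singleton_iff]
    tauto
  rw [hs, coplanar_insert_iff_of_mem_affineSpan he]
  exact coplanar_triple ℝ a b d

/-- Two functions on a finite type whose fibres have the same sizes differ by a permutation. -/
theorem exists_perm_comp_eq_of_card_fiber_eq {α β : Type*} [Fintype α] [DecidableEq β]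
    (f g : α → β)
    (h : ∀ y, Fintype.card {i // f i = y} = Fintype.card {i // g i = y}) :
    ∃ σ : Equiv.Perm α, ∀ i, g (σ i) = f i :=
  ⟨Equiv.ofFiberEquiv fun y => Fintype.equivOfCardEq (h y), fun i =>
    Equiv.ofFiberEquiv_map _ i⟩

/-- An invariant colouring depends only on the sizes of the joint fibres of an edge. -/
theorem colour_eq_of_card_fiber_eq {n : ℕ} {c : Sym2 (Fin n → Bool) → Bool}
    (hc : ∀ σ : Equiv.Perm (Fin n), ∀ u v : Fin n → Bool, u ≠ v →
      c s(permAct n σ u, permAct n σ v) = c s(u, v))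
    {u v u' v' : Fin n → Bool} (huv : u ≠ v)
    (h : ∀ y : Bool × Bool,
      Fintype.card {i // (u' i, v' i) = y} = Fintype.card {i // (u i, v i) = y}) :
    c s(u', v') = c s(u, v) := by
  obtain ⟨σ, hσ⟩ := exists_perm_comp_eq_of_card_fiber_eq
    (fun i => (u' i, v' i)) (fun i => (u i, v i)) h
  rw [← hc σ⁻¹ u v huv]
  congr 2
  · funext i
    simpa [permAct] using (congrArg Prod.fst (hσ i)).symm
  · funext i
    simpa [permAct] using (congrArg Prod.snd (hσ i)).symm

/-- The vertex of `C_10` with five ones obtained from `1111100000` by moving ones to the second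
half: in position `i < a` of the first half iff `s`, and in position `a ≤ i < a + b` iff `t`. -/
def rectVertex (a b : ℕ) (s t : Bool) (i : Fin 10) : Bool :=
  xor (decide (i.val < 5))
    (if i.val % 5 < a then s else if i.val % 5 < a + b then t else false)

theorem rectVertex_add_eq_add (a b : ℕ) :
    toPoint 10 (rectVertex a b false false) + toPoint 10 (rectVertex a b true true) =
      toPoint 10 (rectVertex a b true false) + toPoint 10 (rectVertex a b false true) := by
  funext i
  simp only [toPoint, rectVertex, Pi.add_apply]
  by_cases h₀ : i.val < 5 <;> by_cases h₁ : i.val % 5 < a <;>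
    by_cases h₂ : i.val % 5 < a + b <;> simp [h₀, h₁, h₂]

/-- The joint fibre sizes of an edge between two vertices with five ones each that share all but
`p` of their ones. -/
def swapCard (p : ℕ) : Bool × Bool → ℕ
  | (true, true) => 5 - p
  | (false, false) => 5 - p
  | _ => p

theorem card_fiber_rectVertex : ∀ a b : Fin 6, a.val + b.val ≤ 5 → ∀ s t s' t' : Bool,
    ∀ y : Bool × Bool,
      Fintype.card {i // (rectVertex a b s t i, rectVertex a b s' t' i) = y} =
        swapCard ((if s = s' then 0 else a.val) + (if t = t' then 0 else b.val)) y := by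
  decide +kernel

theorem rectVertex_ne {a b : ℕ} (ha : 0 < a) (hb : 0 < b) (hab : a + b ≤ 5) {s t s' t' : Bool}
    (h : s ≠ s' ∨ t ≠ t') : rectVertex a b s t ≠ rectVertex a b s' t' := by
  intro he
  have h₁ := congrFun he ⟨0, by omega⟩
  have h₂ := congrFun he ⟨a, by omega⟩
  have ha5 : a % 5 = a := Nat.mod_eq_of_lt (by omega)
  simp [rectVertex, ha, hb, ha5] at h₁ h₂
  tauto

/-- An invariant colouring without monochromatic planar `K₄` induces a colouring of the possible
sizes `1, …, 5` of differences of five-element sets; it has no monochromatic Schur triple. -/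
theorem not_mono_schur_triple {c : Sym2 (Fin 10 → Bool) → Bool} (hg : NoMonoPlanarK4 10 c)
    (hc : ∀ σ : Equiv.Perm (Fin 10), ∀ u v : Fin 10 → Bool, u ≠ v →
      c s(permAct 10 σ u, permAct 10 σ v) = c s(u, v))
    {x : ℕ → Bool}
    (hx : ∀ p, x p = c s(rectVertex p 0 false false, rectVertex p 0 true false))
    {a b : ℕ} (ha : 0 < a) (hb : 0 < b) (hab : a + b ≤ 5) :
    ¬ (x a = x b ∧ x a = x (a + b)) := by
  have key : ∀ s t s' t' : Bool, (s ≠ s' ∨ t ≠ t') →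
      c s(rectVertex a b s t, rectVertex a b s' t') =
        x ((if s = s' then 0 else a) + (if t = t' then 0 else b)) := by
    intro s t s' t' h
    set p := (if s = s' then 0 else a) + (if t = t' then 0 else b) with hp
    have hp5 : 0 < p ∧ p ≤ 5 := by
      rcases h with h | h <;> simp only [hp, h, if_false] <;> split_ifs <;> omega
    rw [hx]
    refine colour_eq_of_card_fiber_eq hc ?_ fun y => ?_
    · intro he
      have h₁ := congrFun he ⟨0, by omega⟩
      simp [rectVertex, hp5.1] at h₁
    · have h₁ := card_fiber_rectVertex ⟨a, by omega⟩ ⟨b, by omega⟩ hab s t s' t' y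
      have h₂ := card_fiber_rectVertex ⟨p, by omega⟩ 0 hp5.2 false false true false y
      simp only [Fin.val_zero, reduceCtorEq, if_false, if_true, add_zero] at h₁ h₂
      exact h₁.trans h₂.symm
  intro ⟨h₁, h₂⟩
  have ne := @rectVertex_ne a b ha hb hab
  refine hg (rectVertex a b false false) (rectVertex a b true false)
    (rectVertex a b false true) (rectVertex a b true true)
    (ne (by simp)) (ne (by simp)) (ne (by simp)) (ne (by simp)) (ne (by simp)) (ne (by simp))
    (coplanar_of_add_eq_add (rectVertex_add_eq_add a b)) ?_
  rw [key _ _ _ _ (by simp), key _ _ _ _ (by simp), key _ _ _ _ (by simp),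
    key _ _ _ _ (by simp), key _ _ _ _ (by simp), key _ _ _ _ (by simp)]
  simp [← h₁, ← h₂]

theorem no_S10_invariant_good_colouring :
    ¬ ∃ c : Sym2 (Fin 10 → Bool) → Bool, NoMonoPlanarK4 10 c ∧
      ∀ σ : Equiv.Perm (Fin 10), ∀ u v : Fin 10 → Bool, u ≠ v →
        c s(permAct 10 σ u, permAct 10 σ v) = c s(u, v) := by
  rintro ⟨c, hg, hc⟩
  obtain ⟨x, hx⟩ : ∃ x : ℕ → Bool, ∀ p,
      x p = c s(rectVertex p 0 false false, rectVertex p 0 true false) := ⟨_, fun _ => rfl⟩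
  have schur : ∀ a b : ℕ, 0 < a → 0 < b → a + b ≤ 5 → ¬ (x a = x b ∧ x a = x (a + b)) :=
    fun _ _ => not_mono_schur_triple hg hc hx
  have h₁₁ := schur 1 1 (by norm_num) (by norm_num) (by norm_num)
  have h₁₃ := schur 1 3 (by norm_num) (by norm_num) (by norm_num)
  have h₁₄ := schur 1 4 (by norm_num) (by norm_num) (by norm_num)
  have h₂₂ := schur 2 2 (by norm_num) (by norm_num) (by norm_num)
  have h₂₃ := schur 2 3 (by norm_num) (by norm_num) (by norm_num)
  norm_num at h₁₁ h₁₃ h₁₄ h₂₂ h₂₃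
  generalize x 1 = x₁, x 2 = x₂, x 3 = x₃, x 4 = x₄, x 5 = x₅ at *
  revert x₁ x₂ x₃ x₄ x₅
  decide
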